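/- arXiv:2112.07046 — 3 statements merged into one kernel-verified Lean document; each statement's English description precedes it below -/
import Mathlib

section
/- Let S be a set of k prime numbers such that every p ∈ S satisfies p ≥ k^{1/2}. Then for every real x > 0 one has Θ(x, S) ≤ exp(10·(log x/log* k)·log*(k·log* k/log x)). -/
/-- `log* t = max {log t, 1}`. -/
noncomputable def logast (t : ℝ) : ℝ := max (Real.log t) 1

/-- `Theta x S` counts the positive integers `n ≤ x` all of whose prime factors lie in `S`
(the `S`-units up to `x`). -/
noncomputable def Theta (x : ℝ) (S : Finset ℕ) : ℕ :=
  {n : ℕ | 0 < n ∧ (n : ℝ) ≤ x ∧ ∀ p : ℕ, p.Prime → p ∣ n → p ∈ S}.ncard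

/-- The completely multiplicative function `n ↦ n ^ (-σ)`. -/
noncomputable def natRpowNegHom (σ : ℝ) : ℕ →* ℝ where
  toFun n := (n : ℝ) ^ (-σ)
  map_one' := by simp
  map_mul' m n := by
    rw [Nat.cast_mul, Real.mul_rpow m.cast_nonneg n.cast_nonneg]

lemma theta_set_finite (x : ℝ) (S : Finset ℕ) :
    {n : ℕ | 0 < n ∧ (n : ℝ) ≤ x ∧ ∀ p : ℕ, p.Prime → p ∣ n → p ∈ S}.Finite :=
  (Set.finite_Iic ⌊x⌋₊).subset fun _ hn ↦ Nat.le_floor hn.2.1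

/-- Rankin's bound for the number of `S`-units up to `x`. -/
lemma theta_le_rpow_mul_prod {S : Finset ℕ} (hS : ∀ p ∈ S, p.Prime) {x σ : ℝ} (hx : 0 < x)
    (hσ : 0 < σ) : (Theta x S : ℝ) ≤ x ^ σ * ∏ p ∈ S, (1 - (p : ℝ) ^ (-σ))⁻¹ := by
  have h := (EulerProduct.summable_and_hasSum_factoredNumbers_prod_filter_prime_geometric
    (f := natRpowNegHom σ) (fun {p} hp ↦ by
      have hp1 : (1 : ℝ) < p := by exact_mod_cast hp.one_lt
      change ‖(p : ℝ) ^ (-σ)‖ < 1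
      rw [Real.norm_of_nonneg (by positivity)]
      exact Real.rpow_lt_one_of_one_lt_of_neg hp1 (neg_neg_of_pos hσ)) S).2
  rw [Finset.filter_true_of_mem hS] at h
  change HasSum ((natRpowNegHom σ) ∘ ((↑) : Nat.factoredNumbers S → ℕ))
    (∏ p ∈ S, (1 - (p : ℝ) ^ (-σ))⁻¹) at h
  rw [hasSum_subtype_iff_indicator] at h
  have hnonneg (n : ℕ) : 0 ≤ (Nat.factoredNumbers S).indicator (natRpowNegHom σ) n :=
    Set.indicator_nonneg (fun n _ ↦ Real.rpow_nonneg n.cast_nonneg _) n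
  have hle := sum_le_hasSum (theta_set_finite x S).toFinset (fun n _ ↦ hnonneg n) h
  have hcard : (Theta x S : ℝ) * x ^ (-σ) ≤
      ∑ n ∈ (theta_set_finite x S).toFinset,
        (Nat.factoredNumbers S).indicator (natRpowNegHom σ) n := by
    rw [Theta, Set.ncard_eq_toFinset_card _ (theta_set_finite x S), ← nsmul_eq_mul]
    refine Finset.card_nsmul_le_sum _ _ _ fun n hn ↦ ?_
    obtain ⟨hn0, hnx, hnS⟩ := (theta_set_finite x S).mem_toFinset.mp hn
    rw [Set.indicator_of_mem (Nat.mem_factoredNumbers'.mpr hnS)]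
    exact Real.rpow_le_rpow_of_nonpos (by exact_mod_cast hn0) hnx (by linarith)
  have hxσ : 0 < x ^ σ := Real.rpow_pos_of_pos hx σ
  rw [Real.rpow_neg hx.le, ← div_eq_mul_inv, div_le_iff₀ hxσ] at hcard
  calc (Theta x S : ℝ) ≤ _ := hcard
    _ ≤ _ := by rw [mul_comm]; gcongr

lemma logast_pos (t : ℝ) : 0 < logast t :=
  lt_of_lt_of_le one_pos (le_max_right _ _)

lemma theta_le_one_of_forall {x : ℝ} {S : Finset ℕ}
    (h : ∀ n : ℕ, 0 < n → (n : ℝ) ≤ x → (∀ p : ℕ, p.Prime → p ∣ n → p ∈ S) → n = 1) :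
    Theta x S ≤ 1 :=
  (Set.ncard_le_ncard (t := {1}) (fun n hn ↦ h n hn.1 hn.2.1 hn.2.2)
    (Set.finite_singleton 1)).trans (Set.ncard_singleton 1).le

/-- A prime `p ≥ √k` satisfies `log p ≥ log* k / 2`. -/
lemma logast_le_two_mul_log {k p : ℕ} (hp : p.Prime) (hkp : √(k : ℝ) ≤ p) :
    logast k ≤ 2 * Real.log p := by
  have hp2 : (2 : ℝ) ≤ p := by exact_mod_cast hp.two_le
  refine max_le ?_ ?_
  · rcases Nat.eq_zero_or_pos k with rfl | hk
    · simpa using Real.log_nonneg (by linarith)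
    · have hk' : (0 : ℝ) < k := by exact_mod_cast hk
      have h := Real.log_le_log (Real.sqrt_pos.mpr hk') hkp
      rw [Real.log_sqrt hk'.le] at h
      linarith
  · have h := Real.log_le_log two_pos hp2
    linarith [Real.log_two_gt_d9]

lemma one_add_log_le_logast {r : ℝ} (hr : 0 < r) :
    1 + Real.log (1 + r / 2) ≤ 2 * logast r := by
  have h1 : 1 ≤ logast r := le_max_right _ _
  have h2 : Real.log r ≤ logast r := le_max_left _ _
  rcases le_total r 2 with h | h
  · have := Real.log_le_sub_one_of_pos (x := 1 + r / 2) (by positivity)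
    linarith
  · have := Real.log_le_log (x := 1 + r / 2) (y := r) (by positivity) (by linarith)
    linarith

theorem S_unit_count_bound_large_primes (S : Finset ℕ) (hS : ∀ p ∈ S, p.Prime)
    (hbig : ∀ p ∈ S, Real.sqrt S.card ≤ (p : ℝ))
    (x : ℝ) (hx : 0 < x) :
    (Theta x S : ℝ) ≤
      Real.exp (10 * (Real.log x / logast S.card) *
        logast (S.card * logast S.card / Real.log x)) := by
  set L := logast S.card with hL
  have hL0 : 0 < L := logast_pos _
  rcases lt_or_ge x 1 with hx1 | hx1
  · have h0 : Theta x S = 0 := by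
      rw [Theta, Set.ncard_eq_zero (theta_set_finite x S)]
      refine Set.eq_empty_of_forall_notMem fun n hn ↦ ?_
      have : (1 : ℝ) ≤ n := by exact_mod_cast hn.1
      linarith [hn.2.1]
    rw [h0, Nat.cast_zero]
    positivity
  have hlog : 0 ≤ Real.log x := Real.log_nonneg hx1
  by_cases htriv : x = 1 ∨ S = ∅
  · have h1 : Theta x S ≤ 1 := by
      refine theta_le_one_of_forall fun n hn hnx hnS ↦ ?_
      rcases htriv with rfl | rfl
      · have : n ≤ 1 := by exact_mod_cast hnx
        omega
      · by_contra hne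
        obtain ⟨p, hp, hpn⟩ := Nat.exists_prime_and_dvd hne
        simpa using hnS p hp hpn
    calc (Theta x S : ℝ) ≤ 1 := by exact_mod_cast h1
      _ ≤ _ := Real.one_le_exp <|
        mul_nonneg (mul_nonneg (by norm_num) (div_nonneg hlog hL0.le)) (logast_pos _).le
  obtain ⟨hxne, hSne⟩ := not_or.mp htriv
  have hlog0 : 0 < Real.log x := Real.log_pos (lt_of_le_of_ne hx1 (Ne.symm hxne))
  have hk : (0 : ℝ) < S.card := by
    exact_mod_cast Finset.card_pos.mpr (Finset.nonempty_iff_ne_empty.mpr hSne)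
  set k := (S.card : ℝ)
  set r : ℝ := k * L / Real.log x with hr
  have hr0 : 0 < r := by positivity
  have ht1 : 1 < 1 + r / 2 := by linarith
  have hlogt : 0 < Real.log (1 + r / 2) := Real.log_pos ht1
  set σ : ℝ := 2 * Real.log (1 + r / 2) / L with hσ
  have hσ0 : 0 < σ := by positivity
  have hfactor : ∀ p ∈ S, 0 ≤ (1 - (p : ℝ) ^ (-σ))⁻¹ ∧
      (1 - (p : ℝ) ^ (-σ))⁻¹ ≤ Real.exp (2 / r) := by
    intro p hp
    have hp0 : (0 : ℝ) < p := by exact_mod_cast (hS p hp).pos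
    have hLp : L ≤ 2 * Real.log p := logast_le_two_mul_log (hS p hp) (hbig p hp)
    have htp : 1 + r / 2 ≤ (p : ℝ) ^ σ := by
      rw [Real.rpow_def_of_pos hp0, ← Real.log_le_iff_le_exp (by positivity), hσ, mul_div_assoc',
        le_div_iff₀ hL0]
      nlinarith
    have hinv : (p : ℝ) ^ (-σ) ≤ (1 + r / 2)⁻¹ := by
      rw [Real.rpow_neg hp0.le]
      exact inv_anti₀ (by positivity) htp
    have heq : 1 - (1 + r / 2)⁻¹ = (1 + 2 / r)⁻¹ := by
      field_simp
      ring
    have hge : (1 + 2 / r)⁻¹ ≤ 1 - (p : ℝ) ^ (-σ) := by linarith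
    have hpos : 0 < (1 + 2 / r)⁻¹ := by positivity
    refine ⟨inv_nonneg.mpr (hpos.le.trans hge), (inv_anti₀ hpos hge).trans ?_⟩
    rw [inv_inv]
    linarith [Real.add_one_le_exp (2 / r)]
  calc (Theta x S : ℝ) ≤ x ^ σ * ∏ p ∈ S, (1 - (p : ℝ) ^ (-σ))⁻¹ :=
        theta_le_rpow_mul_prod hS hx hσ0
    _ ≤ x ^ σ * ∏ _p ∈ S, Real.exp (2 / r) := by
        gcongr with p hp
        · exact fun p hp ↦ (hfactor p hp).1
        · exact (hfactor p hp).2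
    _ = Real.exp (2 * (Real.log x / L) * (1 + Real.log (1 + r / 2))) := by
        rw [Finset.prod_const, ← Real.exp_nat_mul, Real.rpow_def_of_pos hx, ← Real.exp_add]
        congr 1
        change Real.log x * σ + k * (2 / r) = _
        rw [hσ, hr]
        field_simp
        ring
    _ ≤ Real.exp (10 * (Real.log x / L) * logast r) := by
        have h := one_add_log_le_logast hr0
        have hu : 0 < Real.log x / L := by positivity
        have hlr := logast_pos r
        refine Real.exp_le_exp.mpr ?_
        nlinarith [mul_le_mul_of_nonneg_left h hu.le, mul_pos hu hlr]
end

section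
/- Let α be a complex number with |α| ≥ √2. Then for every positive integer n one has |Σ_{d ∣ n} μ(n/d)·log|1 − α^{−d}|| < 5, where the sum is over the positive divisors d of n and μ is the Möbius function. -/
theorem abs_log_norm_one_sub_le {z : ℂ} (hz : ‖z‖ ^ 2 ≤ 1 / 2) :
    |Real.log ‖1 - z‖| ≤ 2 * ‖z‖ := by
  have h0 := norm_nonneg z
  have h1 : ‖z‖ < 1 := by nlinarith
  have hlow : 1 - ‖z‖ ≤ ‖1 - z‖ := by simpa using norm_sub_norm_le (1 : ℂ) z
  have hupp : ‖1 - z‖ ≤ 1 + ‖z‖ := by simpa using norm_sub_le (1 : ℂ) z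
  have hpos : 0 < ‖1 - z‖ := by linarith
  rw [abs_le]
  constructor
  · rw [Real.le_log_iff_exp_le hpos, Real.exp_neg]
    refine le_trans ?_ hlow
    rw [inv_le_iff_one_le_mul₀ (Real.exp_pos _)]
    have hexp := Real.quadratic_le_exp_of_nonneg (x := 2 * ‖z‖) (by positivity)
    calc (1 : ℝ) ≤ (1 - ‖z‖) * (1 + 2 * ‖z‖ + (2 * ‖z‖) ^ 2 / 2) := by
          nlinarith [mul_nonneg h0 (sub_nonneg.2 hz)]
      _ ≤ (1 - ‖z‖) * Real.exp (2 * ‖z‖) :=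
          mul_le_mul_of_nonneg_left hexp (by linarith)
  · linarith [Real.log_le_sub_one_of_pos hpos]

theorem sum_divisors_pow_le {x : ℝ} (h0 : 0 ≤ x) (h1 : x < 1) (n : ℕ) :
    ∑ d ∈ n.divisors, x ^ d ≤ x / (1 - x) := by
  have hsum := (summable_geometric_of_lt_one h0 h1).sum_le_tsum (insert 0 n.divisors)
    fun d _ ↦ pow_nonneg h0 d
  rw [Finset.sum_insert (by simp), tsum_geometric_of_lt_one h0 h1, pow_zero] at hsum
  have hne : 1 - x ≠ 0 := by linarith
  have heq : x / (1 - x) = (1 - x)⁻¹ - 1 := by field_simp; ring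
  linarith

theorem moebius_log_sum_bound (α : ℂ) (hα : Real.sqrt 2 ≤ ‖α‖) (n : ℕ) (hn : 0 < n) :
    |∑ d ∈ n.divisors,
        (ArithmeticFunction.moebius (n / d) : ℝ) * Real.log ‖(1 : ℂ) - α⁻¹ ^ d‖| < 5 := by
  have h0 := norm_nonneg α⁻¹
  have hsq : ‖α⁻¹‖ ^ 2 ≤ 1 / 2 := by
    rw [norm_inv, inv_pow, one_div]
    exact inv_anti₀ two_pos ((Real.sqrt_le_left (norm_nonneg α)).1 hα)
  have h57 : ‖α⁻¹‖ < 5 / 7 := by nlinarith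
  have h1 : ‖α⁻¹‖ < 1 := by linarith
  calc _ ≤ ∑ d ∈ n.divisors, 2 * ‖α⁻¹‖ ^ d := by
        refine (Finset.abs_sum_le_sum_abs _ _).trans (Finset.sum_le_sum fun d hd ↦ ?_)
        have hd0 : d ≠ 0 := (Nat.pos_of_mem_divisors hd).ne'
        have hμ : |(ArithmeticFunction.moebius (n / d) : ℝ)| ≤ 1 := by
          exact_mod_cast ArithmeticFunction.abs_moebius_le_one
        have hlog : |Real.log ‖(1 : ℂ) - α⁻¹ ^ d‖| ≤ 2 * ‖α⁻¹ ^ d‖ := by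
          refine abs_log_norm_one_sub_le (le_trans ?_ hsq)
          rw [norm_pow]
          exact pow_le_pow_left₀ (by positivity) (pow_le_of_le_one h0 h1.le hd0) 2
        rw [abs_mul, ← norm_pow]
        exact (mul_le_of_le_one_left (abs_nonneg _) hμ).trans hlog
    _ ≤ 2 * (‖α⁻¹‖ / (1 - ‖α⁻¹‖)) := by
        rw [← Finset.mul_sum]
        exact mul_le_mul_of_nonneg_left (sum_divisors_pow_le h0 h1 n) two_pos.le
    _ < 5 := by
        rw [← mul_div_assoc, div_lt_iff₀ (by linarith)]
        linarith
end

section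
/- For every integer n ≥ exp(exp(10^{10})), the number of divisors d of n with d < τ(n)·log n is at most exp(70·log n·log log log n/(log log n)²), where τ(n) denotes the number of positive divisors of n. -/
open Finset Real in
/-- A sum of negative powers over the divisors of `n` is bounded by an Euler product. -/
theorem sum_divisors_rpow_neg_le_prod {n : ℕ} (hn : n ≠ 0) {s : ℝ} (hs : 0 ≤ s) :
    ∑ d ∈ n.divisors, (d : ℝ) ^ (-s) ≤
      n.factorization.prod fun p k => 1 + k * (p : ℝ) ^ (-s) := by
  let F : ArithmeticFunction ℝ := ⟨fun d => if d = 0 then 0 else (d : ℝ) ^ (-s), by simp⟩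
  have hF : ∀ d : ℕ, d ≠ 0 → F d = (d : ℝ) ^ (-s) := fun d hd => by simp [F, hd]
  have hFm : F.IsMultiplicative := by
    refine ArithmeticFunction.IsMultiplicative.iff_ne_zero.2 ⟨by simp [F], fun {a b} ha hb _ => ?_⟩
    rw [hF _ (mul_ne_zero ha hb), hF _ ha, hF _ hb, Nat.cast_mul,
      mul_rpow (Nat.cast_nonneg a) (Nat.cast_nonneg b)]
  have hsum : ∀ m : ℕ, (F * ArithmeticFunction.zeta) m = ∑ d ∈ m.divisors, (d : ℝ) ^ (-s) := by
    intro m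
    rw [ArithmeticFunction.coe_mul_zeta_apply]
    exact sum_congr rfl fun d hd => hF d (Nat.pos_of_mem_divisors hd).ne'
  rw [← hsum, ArithmeticFunction.IsMultiplicative.multiplicative_factorization _
    (hFm.mul ArithmeticFunction.isMultiplicative_zeta.natCast) hn]
  simp only [hsum]
  refine prod_le_prod (fun p _ => sum_nonneg fun d _ => by positivity) fun p hp => ?_
  have hpp : p.Prime := Nat.prime_of_mem_primeFactors hp
  beta_reduce
  rw [Nat.sum_divisors_prime_pow hpp, sum_range_succ']
  simp only [pow_zero, Nat.cast_one, one_rpow]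
  rw [add_comm]
  gcongr
  refine (sum_le_card_nsmul _ _ ((p : ℝ) ^ (-s)) fun i _ => ?_).trans (by simp)
  refine rpow_le_rpow_of_nonpos (by exact_mod_cast hpp.pos) ?_ (by linarith)
  exact_mod_cast Nat.le_self_pow (Nat.succ_ne_zero i) p

open Finset Real in
/-- A bound for the sum of `d ^ (-s)` over the divisors `d` of `n`, obtained by splitting the prime
divisors of `n` at `√(log n)`. -/
theorem sum_divisors_rpow_neg_le_exp {n : ℕ} {l s : ℝ} (hl : 2 ≤ l) (hn : log n = exp l)
    (hs : 0 ≤ s) :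
    ∑ d ∈ n.divisors, (d : ℝ) ^ (-s) ≤
      exp (2 * l * exp (l / 2) + 2 * exp (-(s * l / 2)) * exp l / l) := by
  have hl0 : 0 < l := by linarith
  have hn0 : n ≠ 0 := by
    rintro rfl
    simp [(exp_pos l).ne] at hn
  set c := exp (-(s * l / 2)) with hc
  have hc0 : 0 < c := exp_pos _
  set T := n.primeFactors.filter fun p : ℕ => (p : ℝ) ≤ exp (l / 2) with hT
  have hTcard : (#T : ℝ) ≤ exp (l / 2) := by
    have h : T ⊆ Icc 1 ⌊exp (l / 2)⌋₊ := fun p hp => by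
      rw [hT, mem_filter] at hp
      exact mem_Icc.2 ⟨(Nat.prime_of_mem_primeFactors hp.1).pos, Nat.le_floor hp.2⟩
    have h2 := card_le_card h
    rw [Nat.card_Icc, Nat.add_sub_cancel] at h2
    exact (Nat.cast_le.2 h2).trans (Nat.floor_le (exp_pos _).le)
  have key : ∀ p ∈ n.primeFactors, 1 + (n.factorization p : ℝ) * (p : ℝ) ^ (-s) ≤
      exp ((if (p : ℝ) ≤ exp (l / 2) then 2 * l else 0) +
        2 * c / l * (n.factorization p * log p)) := by
    intro p hp
    have hpp : p.Prime := Nat.prime_of_mem_primeFactors hp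
    have hp1 : (1 : ℝ) < p := by exact_mod_cast hpp.one_lt
    have hlogp : 0 < log p := log_pos hp1
    set a := n.factorization p with ha
    split_ifs with hple
    · have hps : (p : ℝ) ^ (-s) ≤ 1 := rpow_le_one_of_one_le_of_nonpos hp1.le (by linarith)
      have h2a : (2 : ℝ) ^ a ≤ n := by
        have h1 : 2 ^ a ≤ p ^ a := Nat.pow_le_pow_left hpp.two_le a
        exact_mod_cast h1.trans (Nat.ordProj_le p hn0)
      have h3 : a * log 2 ≤ exp l := by
        rw [← hn, ← log_pow]
        exact log_le_log (by positivity) h2a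
      have h4 : (a : ℝ) ≤ 2 * exp l := by nlinarith [log_two_gt_d9, Nat.cast_nonneg (α := ℝ) a]
      have h5 : 3 ≤ exp l := by linarith [add_one_le_exp l]
      calc 1 + (a : ℝ) * (p : ℝ) ^ (-s) ≤ 1 + a * 1 := by gcongr
        _ ≤ exp l * exp l := by nlinarith
        _ = exp (2 * l) := by rw [← exp_add]; ring_nf
        _ ≤ _ := by gcongr; rw [le_add_iff_nonneg_right]; positivity
    · push Not at hple
      have hlp : l / 2 ≤ log p := (le_log_iff_exp_le (by linarith)).2 hple.le
      have hps : (p : ℝ) ^ (-s) ≤ c := by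
        rw [rpow_def_of_pos (by linarith), hc]
        gcongr
        nlinarith
      have h1 : 1 ≤ 2 / l * log p := by
        rw [div_mul_eq_mul_div, one_le_div hl0]
        linarith
      calc 1 + (a : ℝ) * (p : ℝ) ^ (-s) ≤ 1 + a * c := by gcongr
        _ ≤ exp (a * c) := by rw [add_comm]; exact add_one_le_exp _
        _ ≤ _ := by
          gcongr
          calc (a : ℝ) * c = a * c * 1 := by ring
            _ ≤ a * c * (2 / l * log p) := by gcongr
            _ = _ := by ring
  refine (sum_divisors_rpow_neg_le_prod hn0 hs).trans ?_
  rw [Finsupp.prod, Nat.support_factorization]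
  refine (prod_le_prod (fun p _ => by positivity) key).trans ?_
  rw [← exp_sum, sum_add_distrib, ← mul_sum, ← sum_filter, sum_const, nsmul_eq_mul]
  have hlog := log_nat_eq_sum_factorization n
  rw [Finsupp.sum, Nat.support_factorization, hn] at hlog
  rw [← hlog]
  gcongr exp (?_ + ?_)
  · rw [mul_comm]
    gcongr
  · exact le_of_eq (by ring)

open Finset Real in
/-- Rankin's bound for the number of divisors of `n` less than `exp x`. -/
theorem ncard_divisors_lt_le_rankin {n : ℕ} (hn : n ≠ 0) {x s : ℝ} (hs : 0 ≤ s) :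
    ({d : ℕ | d ∣ n ∧ (d : ℝ) < exp x}.ncard : ℝ) ≤
      exp (s * x) * ∑ d ∈ n.divisors, (d : ℝ) ^ (-s) := by
  have hset : {d : ℕ | d ∣ n ∧ (d : ℝ) < exp x} =
      (n.divisors.filter fun d : ℕ => (d : ℝ) < exp x : Finset ℕ) := by
    ext d
    simp [hn]
  rw [hset, Set.ncard_coe_finset, card_eq_sum_ones, Nat.cast_sum, mul_sum, sum_filter]
  refine sum_le_sum fun d hd => ?_
  have hd0 : (0 : ℝ) < d := by exact_mod_cast Nat.pos_of_mem_divisors hd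
  split_ifs with h
  · rw [rpow_def_of_pos hd0, ← exp_add, Nat.cast_one, one_le_exp_iff]
    nlinarith [(log_lt_iff_lt_exp hd0).2 h]
  · positivity

theorem count_small_divisors_bound (n : ℕ) (hn : Real.exp (Real.exp (10 ^ 10)) ≤ (n : ℝ)) :
    ({d : ℕ | d ∣ n ∧ (d : ℝ) < (n.divisors.card : ℝ) * Real.log n}.ncard : ℝ) ≤
      Real.exp (70 * Real.log n * Real.log (Real.log (Real.log n)) /
        (Real.log (Real.log n)) ^ 2) := by
  have hn0 : (0 : ℝ) < n := (Real.exp_pos _).trans_le hn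
  have hn0' : n ≠ 0 := by exact_mod_cast hn0.ne'
  have hL : Real.exp (10 ^ 10) ≤ Real.log n := (Real.le_log_iff_exp_le hn0).2 hn
  have hL0 : 0 < Real.log n := (Real.exp_pos _).trans_le hL
  have hl : 10 ^ 10 ≤ Real.log (Real.log n) := (Real.le_log_iff_exp_le hL0).2 hL
  have hLexp : Real.log n = Real.exp (Real.log (Real.log n)) := (Real.exp_log hL0).symm
  set L := Real.log n
  set l := Real.log L
  have hl0 : 0 < l := by linarith
  set k := Real.log l with hk
  have hk1 : 1 ≤ k := by
    rw [hk, Real.le_log_iff_exp_le hl0]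
    linarith [Real.exp_one_lt_d9]
  have hexp : Real.exp (-(2 * k / l * l / 2)) = 1 / l := by
    rw [show -(2 * k / l * l / 2) = -k by field_simp, Real.exp_neg, hk, Real.exp_log hl0, one_div]
  have hsmall : l * Real.exp (l / 2) ≤ L / l ^ 2 := by
    have h1 := Real.pow_div_factorial_le_exp (l / 2) (by linarith) 4
    have h2 : l ^ 3 ≤ Real.exp (l / 2) := by
      refine le_trans ?_ h1
      norm_num [Nat.factorial]
      nlinarith [pow_pos hl0 3]
    rw [le_div_iff₀ (by positivity)]
    calc l * Real.exp (l / 2) * l ^ 2 = Real.exp (l / 2) * l ^ 3 := by ring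
      _ ≤ Real.exp (l / 2) * Real.exp (l / 2) := by gcongr
      _ = L := by rw [← Real.exp_add, add_halves, ← hLexp]
  have hM : L / l ^ 2 ≤ L / l := by
    gcongr
    nlinarith
  have hle : l ≤ L / l := by
    refine le_trans ?_ (hsmall.trans hM)
    nlinarith [Real.add_one_le_exp (l / 2)]
  have htau : (n.divisors.card : ℝ) ≤ Real.exp (4 * (L / l)) := by
    have h := sum_divisors_rpow_neg_le_exp (l := l) (by linarith) hLexp le_rfl
    simp only [neg_zero, Real.rpow_zero, Finset.sum_const, nsmul_eq_mul, mul_one, zero_mul,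
      zero_div, Real.exp_zero, ← hLexp] at h
    refine h.trans (Real.exp_le_exp.2 ?_)
    rw [mul_div_assoc]
    linarith
  have hX : (n.divisors.card : ℝ) * L ≤ Real.exp (5 * (L / l)) := by
    calc (n.divisors.card : ℝ) * L ≤ Real.exp (4 * (L / l)) * Real.exp l := by
          rw [← hLexp]
          gcongr
      _ = Real.exp (4 * (L / l) + l) := (Real.exp_add _ _).symm
      _ ≤ _ := by
        gcongr
        linarith
  have hs : 0 ≤ 2 * k / l := by positivity
  have hmono : ({d : ℕ | d ∣ n ∧ (d : ℝ) < (n.divisors.card : ℝ) * L}.ncard : ℝ) ≤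
      {d : ℕ | d ∣ n ∧ (d : ℝ) < Real.exp (5 * (L / l))}.ncard := by
    refine Nat.cast_le.2 (Set.ncard_le_ncard (fun d hd => ⟨hd.1, hd.2.trans_le hX⟩) ?_)
    exact (Set.finite_Iic n).subset fun d hd => Nat.le_of_dvd (Nat.pos_of_ne_zero hn0') hd.1
  refine hmono.trans ((ncard_divisors_lt_le_rankin hn0' hs).trans ?_)
  have hsum := sum_divisors_rpow_neg_le_exp (l := l) (by linarith) hLexp hs
  rw [hexp, ← hLexp] at hsum
  refine (mul_le_mul_of_nonneg_left hsum (Real.exp_pos _).le).trans ?_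
  rw [← Real.exp_add]
  refine Real.exp_le_exp.2 ?_
  have e1 : 2 * k / l * (5 * (L / l)) = 10 * (k * (L / l ^ 2)) := by field_simp; ring
  have e2 : 2 * (1 / l) * L / l = 2 * (L / l ^ 2) := by field_simp
  have e3 : 70 * L * k / l ^ 2 = 70 * (k * (L / l ^ 2)) := by ring
  rw [e1, e2, e3]
  have hkM : L / l ^ 2 ≤ k * (L / l ^ 2) := le_mul_of_one_le_left (by positivity) hk1
  have hM0 : 0 ≤ L / l ^ 2 := by positivity
  linarith
end
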